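/- Let U be an orbifold atlas of dimension n on X, let R := R̂/∼, U := ⨿_{i∈I} Ũ_i, and define s, t : R → U by s([λ_ki, x̃_k, λ_kj]) = (λ_ki(x̃_k), i) and t([λ_ki, x̃_k, λ_kj]) = (λ_kj(x̃_k), j), and let m be the multiplication on composable pairs (t(a) = s(b)) given by m([λ_ih, x̃_i, λ_ij], [λ_kj, x̃_k, λ_kl]) = [λ_ih ∘ λ_fi, x̃_f, λ_kl ∘ λ_fk] for any completion (Ũ_f, x̃_f, λ_fi, λ_fk) with λ_ij ∘ λ_fi = λ_kj ∘ λ_fk, λ_fi(x̃_f) = x̃_i, λ_fk(x̃_f) = x̃_k (this is well defined). Then m is associative: for all a, b, c ∈ R with t(a) = s(b) and t(b) = s(c), one has m(m(a, b), c) = m(a, m(b, c)). -/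

import Mathlib

open Set

noncomputable section

/-- `ℂⁿ`. -/
abbrev CC (n : ℕ) : Type := EuclideanSpace ℂ (Fin n)

/-- A (reduced complex) uniformizing system of dimension `n` for the open set
`U := p '' Ut` of `X`: `Ut ⊆ ℂⁿ` is a nonempty connected open set, `G` is a finite
group of holomorphic automorphisms of `Ut` (encoded as total maps that agree with the
identity outside `Ut`, so that `G` is honestly a set of maps closed under composition
and inversion), and `p` (the map `π`) is continuous, surjective and `G`-invariant on
`Ut`, inducing a homeomorphism `Ut/G ≃ U` (encoded by: the fibres of `p` on `Ut` are
exactly the `G`-orbits and `p` is an open map on `Ut`). -/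
structure UniformizingSystem (n : ℕ) (X : Type*) [TopologicalSpace X] where
  Ut : Set (CC n)
  isOpen_Ut : IsOpen Ut
  isConnected_Ut : IsConnected Ut
  G : Set (CC n → CC n)
  finite_G : G.Finite
  id_mem_G : (id : CC n → CC n) ∈ G
  comp_mem_G : ∀ g ∈ G, ∀ h ∈ G, (g ∘ h) ∈ G
  inv_mem_G : ∀ g ∈ G, ∃ g' ∈ G, (∀ x, g' (g x) = x) ∧ (∀ x, g (g' x) = x)
  mapsTo_G : ∀ g ∈ G, Set.MapsTo g Ut Ut
  eqOn_id_G : ∀ g ∈ G, Set.EqOn g id Utᶜ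
  analytic_G : ∀ g ∈ G, AnalyticOnNhd ℂ g Ut
  p : CC n → X
  continuousOn_p : ContinuousOn p Ut
  isOpen_image_p : IsOpen (p '' Ut)
  invariant_p : ∀ g ∈ G, ∀ x ∈ Ut, p (g x) = p x
  exists_g_of_p_eq : ∀ x ∈ Ut, ∀ y ∈ Ut, p x = p y → ∃ g ∈ G, g x = y
  isOpenMap_p : ∀ V : Set (CC n), V ⊆ Ut → IsOpen V → IsOpen (p '' V)

/-- The underlying open subset of `X` uniformized by the system. -/
def UniformizingSystem.U {n : ℕ} {X : Type*} [TopologicalSpace X]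
    (𝒰 : UniformizingSystem n X) : Set X := 𝒰.p '' 𝒰.Ut

/-- An embedding `l : (Ũ,G,π) → (Ṽ,H,φ)` of uniformizing systems: a holomorphic
embedding (injective, biholomorphism onto its open image) with `φ ∘ l = π` on `Ũ`. -/
structure IsUSEmbedding {n : ℕ} {X : Type*} [TopologicalSpace X]
    (𝒰 𝒱 : UniformizingSystem n X) (l : CC n → CC n) : Prop where
  mapsTo : Set.MapsTo l 𝒰.Ut 𝒱.Ut
  injOn : Set.InjOn l 𝒰.Ut
  analyticOn : AnalyticOnNhd ℂ l 𝒰.Ut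
  isOpen_image : IsOpen (l '' 𝒰.Ut)
  exists_analytic_inv : ∃ m : CC n → CC n,
    AnalyticOnNhd ℂ m (l '' 𝒰.Ut) ∧ ∀ x ∈ 𝒰.Ut, m (l x) = x
  comp_p : ∀ x ∈ 𝒰.Ut, 𝒱.p (l x) = 𝒰.p x

/-- A (reduced complex) orbifold atlas of dimension `n` on `X`: a family of
uniformizing systems whose underlying open sets cover `X`, such that any two charts
are compatible at every point of the intersection of their underlying open sets. -/
structure OrbifoldAtlas (n : ℕ) (X : Type*) [TopologicalSpace X] where
  I : Type
  chart : I → UniformizingSystem n X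
  covers : ∀ x : X, ∃ i : I, x ∈ (chart i).U
  compat : ∀ i j : I, ∀ x ∈ (chart i).U ∩ (chart j).U,
    ∃ k : I, x ∈ (chart k).U ∧ (chart k).U ⊆ (chart i).U ∩ (chart j).U ∧
      (∃ l, IsUSEmbedding (chart k) (chart i) l) ∧
      (∃ l, IsUSEmbedding (chart k) (chart j) l)

/-- An element of the set `R̂` associated to an orbifold atlas `𝒰`: a triple
`(λ_ki, x̃_k, λ_kj)` consisting of a chart `(Ũ_k, G_k, π_k)` of `𝒰`, a point
`x̃_k ∈ Ũ_k`, and two embeddings of this chart into charts of `𝒰`. -/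
structure RHat {n : ℕ} {X : Type*} [TopologicalSpace X] (𝒰 : OrbifoldAtlas n X) where
  k : 𝒰.I
  i : 𝒰.I
  j : 𝒰.I
  x : CC n
  hx : x ∈ (𝒰.chart k).Ut
  li : CC n → CC n
  lj : CC n → CC n
  hli : IsUSEmbedding (𝒰.chart k) (𝒰.chart i) li
  hlj : IsUSEmbedding (𝒰.chart k) (𝒰.chart j) lj

/-- The relation `∼` on `R̂`: two triples (with the same pairs of target charts) are
related iff there are a chart `(Ũ_m, G_m, π_m)`, a point `x̃_m ∈ Ũ_m` and embeddings
`λ_mk, λ_ml` making the two diagrams (of embeddings and of marked points) commute.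
Triples whose targets have different index pairs are declared not related. -/
def RRel {n : ℕ} {X : Type*} [TopologicalSpace X] (𝒰 : OrbifoldAtlas n X)
    (a b : RHat 𝒰) : Prop :=
  a.i = b.i ∧ a.j = b.j ∧
  ∃ (m : 𝒰.I) (xm : CC n) (_ : xm ∈ (𝒰.chart m).Ut) (mk ml : CC n → CC n),
    IsUSEmbedding (𝒰.chart m) (𝒰.chart a.k) mk ∧
    IsUSEmbedding (𝒰.chart m) (𝒰.chart b.k) ml ∧
    (∀ y ∈ (𝒰.chart m).Ut, a.li (mk y) = b.li (ml y)) ∧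
    (∀ y ∈ (𝒰.chart m).Ut, a.lj (mk y) = b.lj (ml y)) ∧
    mk xm = a.x ∧ ml xm = b.x

/-- `r` is (a representative of) the product of the composable triples `a` and `b`,
obtained from a completion: a chart `Ũ_f := Ũ_{r.k}` with a point `x̃_f := r.x` and
embeddings `λ_fi, λ_fk` with `λ_ij ∘ λ_fi = λ_kj ∘ λ_fk`, `λ_fi(x̃_f) = x̃_i`,
`λ_fk(x̃_f) = x̃_k`, the product triple being `(λ_ih ∘ λ_fi, x̃_f, λ_kl ∘ λ_fk)`. -/
def IsProductOf {n : ℕ} {X : Type*} [TopologicalSpace X] (𝒰 : OrbifoldAtlas n X)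
    (a b r : RHat 𝒰) : Prop :=
  r.i = a.i ∧ r.j = b.j ∧
  ∃ lfi lfk : CC n → CC n,
    IsUSEmbedding (𝒰.chart r.k) (𝒰.chart a.k) lfi ∧
    IsUSEmbedding (𝒰.chart r.k) (𝒰.chart b.k) lfk ∧
    (∀ y ∈ (𝒰.chart r.k).Ut, a.lj (lfi y) = b.li (lfk y)) ∧
    lfi r.x = a.x ∧ lfk r.x = b.x ∧
    (∀ y ∈ (𝒰.chart r.k).Ut, r.li y = a.li (lfi y)) ∧
    (∀ y ∈ (𝒰.chart r.k).Ut, r.lj y = b.lj (lfk y))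

/-- An analytic map on a connected set that pointwise agrees, on a nonempty open subset, with
members of a finite family of analytic maps agrees with a single member everywhere. -/
lemma AnalyticOnNhd.exists_eqOn_of_finite {E F : Type*} [NormedAddCommGroup E] [NormedSpace ℂ E]
    [CompleteSpace E] [NormedAddCommGroup F] [NormedSpace ℂ F] {V W : Set E}
    (hV : IsPreconnected V) (hW : IsOpen W) (hWne : W.Nonempty) (hWV : W ⊆ V)
    {f : E → F} (hf : AnalyticOnNhd ℂ f V) {S : Set (E → F)} (hS : S.Finite)
    (hSV : ∀ g ∈ S, AnalyticOnNhd ℂ g V) (h : ∀ z ∈ W, ∃ g ∈ S, f z = g z) :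
    ∃ g ∈ S, Set.EqOn f g V := by
  have : BaireSpace W := hW.baireSpace
  have : Nonempty W := hWne.to_subtype
  have : Finite S := hS
  obtain ⟨⟨g, hg⟩, z, hz⟩ := nonempty_interior_of_iUnion_of_closed
    (f := fun g : S => {z : W | f z = g.1 z})
    (fun g => isClosed_eq
      (continuousOn_iff_continuous_domRestrict.1 (hf.continuousOn.mono hWV))
      (continuousOn_iff_continuous_domRestrict.1 ((hSV g g.2).continuousOn.mono hWV)))
    (by
      refine Set.eq_univ_of_forall fun z => ?_
      obtain ⟨g, hg, hz⟩ := h z z.2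
      exact Set.mem_iUnion.2 ⟨⟨g, hg⟩, hz⟩)
  refine ⟨g, hg, hf.eqOn_of_preconnected_of_eventuallyEq (hSV g hg) hV (hWV z.2) ?_⟩
  have hmem := Filter.image_mem_map (m := ((↑) : W → E)) (mem_interior_iff_mem_nhds.1 hz)
  rw [hW.isOpenEmbedding_subtypeVal.map_nhds_eq] at hmem
  filter_upwards [hmem]
  rintro _ ⟨w, hw, rfl⟩
  exact hw

section

variable {n : ℕ} {X : Type*} [TopologicalSpace X] {J K L : UniformizingSystem n X}

lemma UniformizingSystem.image_eq_of_mem_G {g : CC n → CC n} (hg : g ∈ K.G) :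
    g '' K.Ut = K.Ut := by
  obtain ⟨g', hg', -, hr⟩ := K.inv_mem_G g hg
  exact (K.mapsTo_G g hg).image_subset.antisymm fun x hx => ⟨g' x, K.mapsTo_G g' hg' hx, hr x⟩

lemma UniformizingSystem.isUSEmbedding_of_mem_G {g : CC n → CC n} (hg : g ∈ K.G) :
    IsUSEmbedding K K g := by
  obtain ⟨g', hg', hl, -⟩ := K.inv_mem_G g hg
  refine ⟨K.mapsTo_G g hg, fun x _ y _ hxy => ?_, K.analytic_G g hg, ?_, ⟨g', ?_, fun x _ => hl x⟩,
    K.invariant_p g hg⟩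
  · rw [← hl x, hxy, hl y]
  · rw [K.image_eq_of_mem_G hg]; exact K.isOpen_Ut
  · rw [K.image_eq_of_mem_G hg]; exact K.analytic_G g' hg'

lemma IsUSEmbedding.isOpen_image_of_subset {l : CC n → CC n} (hl : IsUSEmbedding K J l)
    {S : Set (CC n)} (hS : IsOpen S) (hSK : S ⊆ K.Ut) : IsOpen (l '' S) := by
  obtain ⟨m, hm, hml⟩ := hl.exists_analytic_inv
  suffices h : l '' S = l '' K.Ut ∩ m ⁻¹' S by
    rw [h]
    exact hm.continuousOn.isOpen_inter_preimage hl.isOpen_image hS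
  refine Set.Subset.antisymm ?_ ?_
  · rintro _ ⟨x, hx, rfl⟩
    exact ⟨⟨x, hSK hx, rfl⟩, by rwa [Set.mem_preimage, hml x (hSK hx)]⟩
  · rintro _ ⟨⟨x, hx, rfl⟩, h⟩
    rw [Set.mem_preimage, hml x hx] at h
    exact ⟨x, h, rfl⟩

lemma IsUSEmbedding.comp {l l' : CC n → CC n} (hl' : IsUSEmbedding K J l')
    (hl : IsUSEmbedding L K l) : IsUSEmbedding L J (l' ∘ l) := by
  obtain ⟨m, hm, hml⟩ := hl.exists_analytic_inv
  obtain ⟨m', hm', hml'⟩ := hl'.exists_analytic_inv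
  refine ⟨hl'.mapsTo.comp hl.mapsTo, hl'.injOn.comp hl.injOn hl.mapsTo,
    hl'.analyticOn.comp hl.analyticOn hl.mapsTo, ?_, ⟨m ∘ m', ?_, fun x hx => ?_⟩, fun x hx => ?_⟩
  · rw [Set.image_comp]
    exact hl'.isOpen_image_of_subset hl.isOpen_image hl.mapsTo.image_subset
  · rw [Set.image_comp]
    refine hm.comp (hm'.mono (Set.image_mono hl.mapsTo.image_subset)) ?_
    rintro _ ⟨_, ⟨x, hx, rfl⟩, rfl⟩
    rw [hml' _ (hl.mapsTo hx)]
    exact ⟨x, hx, rfl⟩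
  · simp [hml' _ (hl.mapsTo hx), hml x hx]
  · simp [hl'.comp_p _ (hl.mapsTo hx), hl.comp_p x hx]

/-- Two embeddings with the same source and target differ by an element of the target group. -/
lemma IsUSEmbedding.exists_mem_G_comp_eqOn {l l' : CC n → CC n} (hl : IsUSEmbedding K J l)
    (hl' : IsUSEmbedding K J l') : ∃ g ∈ J.G, Set.EqOn l (g ∘ l') K.Ut := by
  obtain ⟨_, ⟨g, hg, rfl⟩, h⟩ := AnalyticOnNhd.exists_eqOn_of_finite
    K.isConnected_Ut.isPreconnected K.isOpen_Ut K.isConnected_Ut.nonempty subset_rfl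
    hl.analyticOn (J.finite_G.image fun g => g ∘ l')
    (by
      rintro _ ⟨g, hg, rfl⟩
      exact (J.analytic_G g hg).comp hl'.analyticOn hl'.mapsTo)
    (fun z hz => by
      obtain ⟨g, hg, h⟩ := J.exists_g_of_p_eq _ (hl'.mapsTo hz) _ (hl.mapsTo hz)
        ((hl'.comp_p z hz).trans (hl.comp_p z hz).symm)
      exact ⟨_, ⟨g, hg, rfl⟩, h.symm⟩)
  exact ⟨g, hg, h⟩

/-- An element of the target group which moves some point of the image of an embedding inside
this image is induced by an element of the source group. -/
lemma IsUSEmbedding.exists_mem_G_eqOn_comp {l g : CC n → CC n} (hl : IsUSEmbedding K J l)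
    (hg : g ∈ J.G) {y : CC n} (hy : y ∈ K.Ut) (hgy : g (l y) ∈ l '' K.Ut) :
    ∃ h ∈ K.G, Set.EqOn (g ∘ l) (l ∘ h) K.Ut := by
  have hgl := (J.isUSEmbedding_of_mem_G hg).comp hl
  obtain ⟨_, ⟨h, hh, rfl⟩, he⟩ := AnalyticOnNhd.exists_eqOn_of_finite
    K.isConnected_Ut.isPreconnected
    (hgl.analyticOn.continuousOn.isOpen_inter_preimage K.isOpen_Ut hl.isOpen_image)
    ⟨y, hy, hgy⟩ Set.inter_subset_left hgl.analyticOn (K.finite_G.image fun h => l ∘ h)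
    (by
      rintro _ ⟨h, hh, rfl⟩
      exact hl.analyticOn.comp (K.analytic_G h hh) (K.mapsTo_G h hh))
    (by
      rintro z ⟨hz, w, hw, hwz⟩
      obtain ⟨h, hh, rfl⟩ := K.exists_g_of_p_eq z hz w hw
        (by rw [← hl.comp_p w hw, hwz, hgl.comp_p z hz])
      exact ⟨_, ⟨h, hh, rfl⟩, hwz.symm⟩)
  exact ⟨h, hh, he⟩

/-- An embedding can be corrected so that it maps a given point to a given point over the same
point of the underlying space. -/
lemma IsUSEmbedding.exists_apply_eq {l : CC n → CC n} (hl : IsUSEmbedding K J l) {z x : CC n}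
    (hz : z ∈ K.Ut) (hx : x ∈ J.Ut) (h : K.p z = J.p x) :
    ∃ l', IsUSEmbedding K J l' ∧ l' z = x := by
  obtain ⟨g, hg, hgz⟩ := J.exists_g_of_p_eq _ (hl.mapsTo hz) x hx ((hl.comp_p z hz).trans h)
  exact ⟨g ∘ l, (J.isUSEmbedding_of_mem_G hg).comp hl, hgz⟩

/-- Two embeddings of charts into a common system which agree at marked points can be completed
to a commutative square of embeddings with marked points. -/
lemma OrbifoldAtlas.exists_completion (𝒰 : OrbifoldAtlas n X) {i k : 𝒰.I} {l l' : CC n → CC n}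
    (hl : IsUSEmbedding (𝒰.chart i) J l) (hl' : IsUSEmbedding (𝒰.chart k) J l')
    {x y : CC n} (hx : x ∈ (𝒰.chart i).Ut) (hy : y ∈ (𝒰.chart k).Ut) (hxy : l x = l' y) :
    ∃ f : 𝒰.I, ∃ z ∈ (𝒰.chart f).Ut, ∃ u v : CC n → CC n,
      IsUSEmbedding (𝒰.chart f) (𝒰.chart i) u ∧ IsUSEmbedding (𝒰.chart f) (𝒰.chart k) v ∧
      Set.EqOn (l ∘ u) (l' ∘ v) (𝒰.chart f).Ut ∧ u z = x ∧ v z = y := by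
  have hp : (𝒰.chart k).p y = (𝒰.chart i).p x := by
    rw [← hl.comp_p x hx, ← hl'.comp_p y hy, hxy]
  obtain ⟨f, ⟨z, hz, hzx⟩, -, ⟨u₀, hu₀⟩, ⟨v₀, hv₀⟩⟩ :=
    𝒰.compat i k ((𝒰.chart i).p x) ⟨⟨x, hx, rfl⟩, ⟨y, hy, hp⟩⟩
  obtain ⟨u, hu, huz⟩ := hu₀.exists_apply_eq hz hx hzx
  obtain ⟨v, hv, hvz⟩ := hv₀.exists_apply_eq hz hy (hzx.trans hp.symm)
  obtain ⟨g, hg, hgv⟩ := (hl.comp hu).exists_mem_G_comp_eqOn (hl'.comp hv)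
  have hgy : g (l' y) = l' y := by
    simpa [huz, hvz, hxy] using (hgv hz).symm
  obtain ⟨h, hh, hgh⟩ := hl'.exists_mem_G_eqOn_comp hg hy ⟨y, hy, hgy.symm⟩
  refine ⟨f, z, hz, u, h ∘ v, hu, ((𝒰.chart k).isUSEmbedding_of_mem_G hh).comp hv,
    fun w hw => (hgv hw).trans (hgh (hv.mapsTo hw)), huz, ?_⟩
  have hhy : l' (h y) = l' y := (hgh hy).symm.trans hgy
  simpa [hvz] using hl'.injOn ((𝒰.chart k).mapsTo_G h hh hy) hy hhy

end

/-- Associativity of the multiplication `m` on `R := R̂/∼`: for composable triples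
`a, b, c`, any product of a product of `a, b` with `c` is `∼`-equivalent to any
product of `a` with a product of `b, c`. -/
theorem statement16 {n : ℕ} {X : Type*} [TopologicalSpace X] [T2Space X]
    [SecondCountableTopology X] [ParacompactSpace X]
    (𝒰 : OrbifoldAtlas n X) (a b c ab bc r1 r2 : RHat 𝒰)
    (hab : a.j = b.i) (hptab : a.lj a.x = b.li b.x)
    (hbc : b.j = c.i) (hptbc : b.lj b.x = c.li c.x)
    (hprodab : IsProductOf 𝒰 a b ab) (hprodbc : IsProductOf 𝒰 b c bc)
    (h1 : IsProductOf 𝒰 ab c r1) (h2 : IsProductOf 𝒰 a bc r2) :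
    RRel 𝒰 r1 r2 := by
  obtain ⟨abi, abj, α₁, β₁, hα₁, hβ₁, hαβ, -, hβ₁x, habli, hablj⟩ := hprodab
  obtain ⟨bci, bcj, β₂, γ₂, hβ₂, hγ₂, hβγ, hβ₂x, -, hbcli, hbclj⟩ := hprodbc
  obtain ⟨r1i, r1j, σ, γ₁, hσ, hγ₁, hσγ, hσx, -, hr1li, hr1lj⟩ := h1
  obtain ⟨r2i, r2j, α₂, τ, hα₂, hτ, hατ, -, hτx, hr2li, hr2lj⟩ := h2
  obtain ⟨f, z, hz, u, v, hu, hv, huv, huz, hvz⟩ := 𝒰.exists_completion (hβ₁.comp hσ)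
    (hβ₂.comp hτ) r1.hx r2.hx (by simp [hσx, hτx, hβ₁x, hβ₂x])
  refine ⟨r1i.trans (abi.trans r2i.symm), r1j.trans (r2j.trans bcj).symm, f, z, hz, u, v, hu, hv,
    fun y hy => ?_, fun y hy => ?_, huz, hvz⟩
  all_goals
    have hβ : β₁ (σ (u y)) = β₂ (τ (v y)) := huv hy
    have hu' := hu.mapsTo hy
    have hv' := hv.mapsTo hy
    have hσ' := hσ.mapsTo hu'
    have hτ' := hτ.mapsTo hv'
  · have hα : α₁ (σ (u y)) = α₂ (v y) := a.hlj.injOn (hα₁.mapsTo hσ') (hα₂.mapsTo hv') (by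
      rw [hαβ _ hσ', hβ, hατ _ hv', hbcli _ hτ'])
    rw [hr1li _ hu', habli _ hσ', hα, hr2li _ hv']
  · have hγ : γ₁ (u y) = γ₂ (τ (v y)) := c.hli.injOn (hγ₁.mapsTo hu') (hγ₂.mapsTo hτ') (by
      rw [← hσγ _ hu', hablj _ hσ', hβ, hβγ _ hτ'])
    rw [hr1lj _ hu', hγ, hr2lj _ hv', hbclj _ hτ']
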